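/- arXiv:1309.4846 — 3 statements merged into one kernel-verified Lean document; each statement's English description precedes it below -/
import Mathlib

section
/- Let T be a tree (possibly infinite) and S a nonempty finite subset of its vertices. If a vertex v is not a Jordan infection center with respect to S (i.e., there exists a vertex w with e(w,S) < e(v,S)), then v has a neighbor u with e(u,S) + 1 = e(v,S). -/
/-- In a tree, the neighbour of `u` closer to `s` is unique. -/
theorem closer_unique {V : Type*} {G : SimpleGraph V} (hT : G.IsTree) {s u a b : V}
    (ha : G.Adj u a) (hb : G.Adj u b) (da : G.dist u s = G.dist a s + 1)
    (db : G.dist u s = G.dist b s + 1) : a = b := by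
  obtain ⟨p, hp⟩ := hT.connected.exists_walk_length_eq_dist a s
  obtain ⟨q, hq⟩ := hT.connected.exists_walk_length_eq_dist b s
  have h1 := (SimpleGraph.Walk.cons ha p).isPath_of_length_eq_dist (by simp; omega)
  have h2 := (SimpleGraph.Walk.cons hb q).isPath_of_length_eq_dist (by simp; omega)
  have h := (hT.existsUnique_path u s).unique h1 h2
  have := congrArg SimpleGraph.Walk.snd h
  simpa using this

/-- Once a path moves away from `s`, it keeps moving away. -/
theorem dist_grow {V : Type*} {G : SimpleGraph V} (hT : G.IsTree) (s : V) {u w : V}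
    (p : G.Walk u w) : ∀ (v : V) (h : G.Adj v u), (SimpleGraph.Walk.cons h p).IsPath →
      G.dist u s = G.dist v s + 1 → G.dist w s = G.dist v s + p.length + 1 := by
  induction p with
  | nil => intro v h _ hd; simpa using hd
  | @cons u x w hux p ih =>
    intro v h hp hd
    have hp' := hp.of_cons
    have hne : v ≠ x := by
      rintro rfl
      rw [SimpleGraph.Walk.cons_isPath_iff] at hp
      apply hp.2
      simp
    have hx : G.dist x s = G.dist u s + 1 := by
      have := hT.dist_eq_dist_add_one_of_adj s hux
      rw [G.dist_comm (u := s), G.dist_comm (u := s)] at this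
      rcases this with h1 | h1
      · exact absurd (closer_unique hT h.symm hux hd h1) hne
      · exact h1
    have := ih u hux hp' hx
    simp only [SimpleGraph.Walk.length_cons]
    omega

/-- In a tree with a nonempty finite set `S` of observed infected nodes,
if a vertex `v` is not a Jordan infection center (some vertex `w` has strictly smaller
observed infection eccentricity), then `v` has a neighbor `u` with `e(u,S) + 1 = e(v,S)`. -/
theorem exists_neighbor_smaller_eccentricity {V : Type*} {G : SimpleGraph V} (hT : G.IsTree)
    (S : Finset V) (hS : S.Nonempty) (v : V)
    (hv : ∃ w : V, S.sup' hS (fun s => G.dist w s) < S.sup' hS (fun s => G.dist v s)) :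
    ∃ u : V, G.Adj v u ∧
      S.sup' hS (fun s => G.dist u s) + 1 = S.sup' hS (fun s => G.dist v s) := by
  obtain ⟨w, hw⟩ := hv
  obtain ⟨p, hp, -⟩ := hT.existsUnique_path v w
  cases p with
  | nil => exact absurd hw (lt_irrefl _)
  | @cons _ u _ h p =>
    refine ⟨u, h, le_antisymm ?_ ?_⟩
    · apply Nat.succ_le_of_lt
      rw [Finset.sup'_lt_iff]
      intro s hs
      have h1 := Finset.le_sup' (fun s => G.dist v s) hs
      have h2 := Finset.le_sup' (fun s => G.dist w s) hs
      have := hT.dist_eq_dist_add_one_of_adj s h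
      rw [G.dist_comm (u := s), G.dist_comm (u := s)] at this
      rcases this with h3 | h3
      · omega
      · have := dist_grow hT s p v h hp h3
        omega
    · apply Finset.sup'_le
      intro s hs
      have h1 := Finset.le_sup' (fun s => G.dist u s) hs
      have h2 := hT.connected.dist_triangle (u := v) (v := u) (w := s)
      have h3 := SimpleGraph.dist_eq_one_iff_adj.2 h
      omega
end

section
/- Let T be a tree (possibly infinite) and S a nonempty finite subset of its vertices. For every vertex v there exists a finite sequence of vertices v = w_0, w_1, …, w_k such that consecutive vertices are adjacent in T, the observed infection eccentricity strictly decreases by one along the sequence (e(w_{i+1},S) + 1 = e(w_i,S) for all 0 ≤ i < k), and the final vertex w_k is a Jordan infection center with respect to S; in particular k = e(v,S) − min_{w} e(w,S). -/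
lemma tree_closer_unique {V : Type*} {G : SimpleGraph V} (hT : G.IsTree) {x a b s : V}
    (ha : G.Adj x a) (hb : G.Adj x b) (hda : G.dist a s + 1 = G.dist x s)
    (hdb : G.dist b s + 1 = G.dist x s) : a = b := by
  obtain ⟨p, hp⟩ := hT.1.exists_walk_length_eq_dist a s
  obtain ⟨q, hq⟩ := hT.1.exists_walk_length_eq_dist b s
  have h1 : (SimpleGraph.Walk.cons ha p).IsPath :=
    SimpleGraph.Walk.isPath_of_length_eq_dist _ (by simp [hp, hda])
  have h2 : (SimpleGraph.Walk.cons hb q).IsPath :=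
    SimpleGraph.Walk.isPath_of_length_eq_dist _ (by simp [hq, hdb])
  have h := hT.2.path_unique ⟨_, h1⟩ ⟨_, h2⟩
  have h3 := congrArg (fun r => r.1.snd) h
  simpa using h3

lemma exists_closer {V : Type*} {G : SimpleGraph V} (hT : G.IsTree) {x u : V} {n : ℕ}
    (h : G.dist x u = n + 1) : ∃ y, G.Adj x y ∧ G.dist y u = n := by
  obtain ⟨p, hp⟩ := hT.1.exists_walk_length_eq_dist x u
  cases p with
  | nil => simp at h
  | cons ha p =>
    refine ⟨_, ha, ?_⟩
    have h1 := SimpleGraph.dist_le p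
    have h2 := SimpleGraph.dist_le (SimpleGraph.Walk.cons ha p)
    simp only [SimpleGraph.Walk.length_cons] at hp h2
    have h3 := hT.dist_eq_dist_add_one_of_adj u ha
    rw [SimpleGraph.dist_comm (u := u), SimpleGraph.dist_comm (u := u)] at h3
    omega

lemma dist_moving_away {V : Type*} {G : SimpleGraph V} (hT : G.IsTree) (u s : V) (n : ℕ) :
    ∀ v v' : V, G.Adj v v' → G.dist v' u = n → G.dist v u = n + 1 →
      G.dist v' s = G.dist v s + 1 → G.dist v' s ≤ G.dist u s := by
  induction n with
  | zero =>
    intro v v' _ h0 _ _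
    rw [hT.1.dist_eq_zero_iff] at h0
    rw [h0]
  | succ n ih =>
    intro v v' ha h1 h2 h3
    obtain ⟨y, hy, hyn⟩ := exists_closer hT h1
    have h4 := hT.dist_eq_dist_add_one_of_adj s hy
    rw [SimpleGraph.dist_comm (u := s), SimpleGraph.dist_comm (u := s)] at h4
    rcases h4 with h4 | h4
    · have := tree_closer_unique hT ha.symm hy h3.symm h4.symm
      subst this
      omega
    · have := ih v' y hy hyn h1 h4
      omega

lemma exists_step {V : Type*} {G : SimpleGraph V} (hT : G.IsTree)
    (S : Finset V) (hS : S.Nonempty) (v u : V)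
    (h : S.sup' hS (fun s => G.dist u s) < S.sup' hS (fun s => G.dist v s)) :
    ∃ y, G.Adj v y ∧
      S.sup' hS (fun s => G.dist y s) + 1 = S.sup' hS (fun s => G.dist v s) := by
  have hne : G.dist v u ≠ 0 := by
    intro h0
    rw [hT.1.dist_eq_zero_iff] at h0
    subst h0
    exact lt_irrefl _ h
  obtain ⟨n, hn⟩ := Nat.exists_eq_succ_of_ne_zero hne
  obtain ⟨y, hy, hyn⟩ := exists_closer hT hn
  refine ⟨y, hy, ?_⟩
  have hd : ∀ s, G.dist v s = G.dist y s + 1 ∨ G.dist y s = G.dist v s + 1 := by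
    intro s
    have h4 := hT.dist_eq_dist_add_one_of_adj s hy
    rwa [SimpleGraph.dist_comm (u := s), SimpleGraph.dist_comm (u := s)] at h4
  have hu : S.sup' hS (fun s => G.dist y s) ≤ S.sup' hS (fun s => G.dist v s) - 1 := by
    apply Finset.sup'_le
    intro s hs
    have e1 := Finset.le_sup' (fun s => G.dist v s) hs
    have e2 := Finset.le_sup' (fun s => G.dist u s) hs
    rcases hd s with h5 | h5
    · omega
    · have := dist_moving_away hT u s n v y hy hyn hn h5
      omega
  have hl : S.sup' hS (fun s => G.dist v s) ≤ S.sup' hS (fun s => G.dist y s) + 1 := by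
    apply Finset.sup'_le
    intro s hs
    have e1 := Finset.le_sup' (fun s => G.dist y s) hs
    rcases hd s with h5 | h5 <;> omega
  omega

lemma exists_descent {V : Type*} {G : SimpleGraph V} (f : V → ℕ)
    (hstep : ∀ v u, f u < f v → ∃ y, G.Adj v y ∧ f y + 1 = f v) (m : ℕ) :
    ∀ v : V, f v = m → ∃ (k : ℕ) (w : ℕ → V),
      w 0 = v ∧ (∀ i < k, G.Adj (w i) (w (i + 1))) ∧
      (∀ i < k, f (w (i + 1)) + 1 = f (w i)) ∧
      (∀ u : V, f (w k) ≤ f u) ∧ k = f v - ⨅ u : V, f u := by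
  induction m with
  | zero =>
    intro v hv
    exact ⟨0, fun _ => v, rfl, by simp, by simp, by simp [hv], by simp [hv]⟩
  | succ m ih =>
    intro v hv
    have : Nonempty V := ⟨v⟩
    by_cases hmin : ∀ u, f v ≤ f u
    · refine ⟨0, fun _ => v, rfl, by simp, by simp, hmin, ?_⟩
      have : f v ≤ ⨅ u : V, f u := le_ciInf hmin
      omega
    · push Not at hmin
      obtain ⟨u, hu⟩ := hmin
      obtain ⟨y, hy, hfy⟩ := hstep v u hu
      obtain ⟨k, w, h0, h1, h2, h3, h4⟩ := ih y (by omega)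
      refine ⟨k + 1, fun i => Nat.casesOn i v w, rfl, ?_, ?_, h3, ?_⟩
      · rintro (_ | i) hi
        · simpa [h0] using hy
        · exact h1 i (by omega)
      · rintro (_ | i) hi
        · simpa [h0] using hfy
        · exact h2 i (by omega)
      · have : ⨅ u : V, f u ≤ f y := ciInf_le (OrderBot.bddBelow _) y
        omega

/-- In a tree with a nonempty finite set `S` of observed infected nodes,
from any vertex `v` there is a finite walk `v = w 0, w 1, …, w k` along edges of the tree
on which the observed infection eccentricity `e(·,S) = max_{s∈S} d(·,s)` strictly
decreases by one at every step, ending at a Jordan infection center `w k`;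
moreover `k = e(v,S) − min_w e(w,S)`. -/
theorem path_to_jordan_infection_center {V : Type*} {G : SimpleGraph V} (hT : G.IsTree)
    (S : Finset V) (hS : S.Nonempty) (v : V) :
    ∃ (k : ℕ) (w : ℕ → V),
      w 0 = v ∧
      (∀ i < k, G.Adj (w i) (w (i + 1))) ∧
      (∀ i < k, S.sup' hS (fun s => G.dist (w (i + 1)) s) + 1
                  = S.sup' hS (fun s => G.dist (w i) s)) ∧
      (∀ u : V, S.sup' hS (fun s => G.dist (w k) s) ≤ S.sup' hS (fun s => G.dist u s)) ∧
      k = S.sup' hS (fun s => G.dist v s) - ⨅ u : V, S.sup' hS (fun s => G.dist u s) := by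
  exact exists_descent (fun x => S.sup' hS (fun s => G.dist x s)) (exists_step hT S hS) _ v rfl
end

section
/- Let T be a tree, S a nonempty finite subset of its vertices, v* a vertex, and c a natural number. Suppose there exist s1, s2 ∈ S with d(s1,s2) = d(s1,v*) + d(v*,s2), and such that e(v*,S) ≤ d(v*,s1) + c and e(v*,S) ≤ d(v*,s2) + c. Then every vertex v satisfying e(v,S) ≤ e(v*,S) (in particular, every Jordan infection center with respect to S) satisfies d(v, v*) ≤ c. -/
/-- In a tree with a nonempty finite set `S` of observed infected nodes:
if two observed infected nodes `s1, s2 ∈ S` lie in distinct branches at `vstar`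
(`d(s1,s2) = d(s1,vstar) + d(vstar,s2)`) and each is within `c` hops of the observed
infection eccentricity of `vstar` (`e(vstar,S) ≤ d(vstar,sᵢ) + c`), then every vertex `v`
with `e(v,S) ≤ e(vstar,S)` (in particular every Jordan infection center) satisfies
`d(v, vstar) ≤ c`. -/
theorem jordan_center_pinned_near_source {V : Type*} {G : SimpleGraph V} (hT : G.IsTree)
    (S : Finset V) (hS : S.Nonempty) (vstar : V) (c : ℕ) (s1 s2 : V)
    (hs1 : s1 ∈ S) (hs2 : s2 ∈ S)
    (hbranch : G.dist s1 s2 = G.dist s1 vstar + G.dist vstar s2)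
    (h1 : S.sup' hS (fun s => G.dist vstar s) ≤ G.dist vstar s1 + c)
    (h2 : S.sup' hS (fun s => G.dist vstar s) ≤ G.dist vstar s2 + c)
    (v : V)
    (hv : S.sup' hS (fun s => G.dist v s) ≤ S.sup' hS (fun s => G.dist vstar s)) :
    G.dist v vstar ≤ c := by
  classical
  have hc := hT.connected
  have e1 : G.dist v s1 ≤ _ := (Finset.le_sup' (fun s => G.dist v s) hs1).trans hv
  have e2 : G.dist v s2 ≤ _ := (Finset.le_sup' (fun s => G.dist v s) hs2).trans hv
  have key : ∀ {a b : V} (p : G.Walk a b), p.length = G.dist a b → vstar ∈ p.support →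
      G.dist a vstar + G.dist vstar b ≤ G.dist a b := by
    intro a b p hp hm
    have h := congrArg SimpleGraph.Walk.length (p.take_spec hm)
    rw [SimpleGraph.Walk.length_append] at h
    have ha := SimpleGraph.dist_le (p.takeUntil vstar hm)
    have hb := SimpleGraph.dist_le (p.dropUntil vstar hm)
    omega
  obtain ⟨q1, hq1⟩ := hc.exists_walk_length_eq_dist s1 vstar
  obtain ⟨q2, hq2⟩ := hc.exists_walk_length_eq_dist vstar s2
  obtain ⟨p1, hp1⟩ := hc.exists_walk_length_eq_dist s1 v
  obtain ⟨p2, hp2⟩ := hc.exists_walk_length_eq_dist v s2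
  have hq : (q1.append q2).IsPath := by
    apply SimpleGraph.Walk.isPath_of_length_eq_dist
    rw [SimpleGraph.Walk.length_append]
    omega
  have heq : (p1.append p2).bypass = q1.append q2 :=
    (hT.existsUnique_path s1 s2).unique (SimpleGraph.Walk.bypass_isPath _) hq
  have hmem : vstar ∈ (p1.append p2).support := by
    apply SimpleGraph.Walk.support_bypass_subset
    rw [heq, SimpleGraph.Walk.mem_support_append_iff]
    exact Or.inl q1.end_mem_support
  have c1 := G.dist_comm (u := s1) (v := v)
  have c2 := G.dist_comm (u := s1) (v := vstar)
  have c3 := G.dist_comm (u := v) (v := vstar)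
  rcases SimpleGraph.Walk.mem_support_append_iff _ _ |>.1 hmem with h | h
  · have := key p1 hp1 h
    omega
  · have := key p2 hp2 h
    omega
end
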